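/- Let A be a finite set with |A| ≥ 2, let n, p, ℓ be positive integers with p+1 ≤ |A|^n, let 0 < η, ε ≤ 1, and let ⟨D_t : t ∈ A^n⟩ be an η-stationary process (with respect to types) with |P(D_t) − ε| ≤ η for all t. Let t = (t₁,…,t_{p+1}) be an ℓ-separated tuple of distinct elements of A^n with type of dimension d, set G := {t₁,…,t_{p+1}}, H := {t₁,…,t_p}, let 0 < θ, σ ≤ 1, let r = (r₁,…,r_ℓ) be positive integers with r₁+⋯+r_ℓ ≤ n−d, and assume the process is (τ(H), θ)-pseudorandom and (τ(G), σ)-supercorrelated. Then there exist an (r₁+⋯+r_ℓ)-dimensional combinatorial subspace V of A^n and a process ⟨S_t : t ∈ V⟩ that is (ℓ, r)-simplicial in V such that for every t ∈ V: |P(S_t) − ε^p| ≤ θ and P(D_t | S_t) ≥ ε(1 + (σε^{-1} − θ)/(ε^p + θ)). -/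

import Mathlib

open MeasureTheory

/-- The type of a tuple `(t₁,…,t_p)` of elements of `A^n`, represented as a list of rows:
form the list of rows of the `n × p` coordinate matrix (row `i` is `j ↦ t_j(i)`),
delete the constant rows, and collapse consecutive identical rows. -/
def typeRows {A : Type*} [DecidableEq A] {n p : ℕ} (t : Fin p → Fin n → A) :
    List (Fin p → A) :=
  (((List.finRange n).map (fun i => fun j => t j i)).filter
      (fun r => decide (∃ j j' : Fin p, r j ≠ r j'))).destutter (· ≠ ·)

/-- Two nonempty finite sets have the same type if they admit enumerations whose
tuple-types coincide. -/
def SameType {A : Type*} [DecidableEq A] {n m : ℕ}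
    (G₁ : Finset (Fin n → A)) (G₂ : Finset (Fin m → A)) : Prop :=
  ∃ (p : ℕ) (t₁ : Fin p → Fin n → A) (t₂ : Fin p → Fin m → A),
    Function.Injective t₁ ∧ Function.Injective t₂ ∧
    (∀ x, x ∈ G₁ ↔ ∃ j, t₁ j = x) ∧ (∀ x, x ∈ G₂ ↔ ∃ j, t₂ j = x) ∧
    typeRows t₁ = typeRows t₂

/-- η-stationarity with respect to types. -/
def StationaryTypes {A Ω : Type*} [DecidableEq A] [MeasurableSpace Ω] {n : ℕ}
    (P : Measure Ω) (D : (Fin n → A) → Set Ω) (η : ℝ) : Prop :=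
  ∀ G₁ G₂ : Finset (Fin n → A), G₁.Nonempty → G₂.Nonempty → SameType G₁ G₂ →
    |(P (⋂ x ∈ G₁, D x)).toReal - (P (⋂ x ∈ G₂, D x)).toReal| ≤ η

/-- A tuple `(t₁,…,t_p)` of elements of `A^n` is `ℓ`-separated if for every `j ≥ 2`
there is a set `I` of `ℓ` coordinates such that every earlier `t_q` differs from `t_j`
at some coordinate of `I`. -/
def SepTuple {A : Type*} {n p : ℕ} (ℓ : ℕ) (t : Fin p → Fin n → A) : Prop :=
  ∀ j : Fin p, 1 ≤ (j : ℕ) → ∃ I : Finset (Fin n), I.card = ℓ ∧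
    ∀ q : Fin p, (q : ℕ) < (j : ℕ) → ∃ i ∈ I, t j i ≠ t q i

/-- The separation index of a tuple: the least positive `ℓ` for which it is `ℓ`-separated. -/
noncomputable def sepIndexTuple {A : Type*} {n p : ℕ} (t : Fin p → Fin n → A) : ℕ :=
  sInf {ℓ | 0 < ℓ ∧ SepTuple ℓ t}

/-- The `l`-th of the successive intervals `I₁,…,I_ℓ` of `[n]` with `|I_l| = r l`. -/
def blockOf {ℓ : ℕ} (r : Fin ℓ → ℕ) (n : ℕ) (l : Fin ℓ) : Finset (Fin n) :=
  Finset.univ.filter (fun i : Fin n =>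
    ∑ l' ∈ Finset.Iio l, r l' ≤ (i : ℕ) ∧ (i : ℕ) < ∑ l' ∈ Finset.Iic l, r l')

/-- `(α,β,I)`-equivalence. -/
def EquivABI {A : Type*} {n : ℕ} (α β : A) (I : Finset (Fin n)) (s t : Fin n → A) : Prop :=
  (∀ i ∉ I, s i = t i) ∧
    ∀ i ∈ I, ∀ γ : A, γ ≠ α → γ ≠ β → (s i = γ ↔ t i = γ)

/-- An `(α,β,I)`-insensitive process. -/
def InsensitiveOn {A Ω : Type*} {n : ℕ} (α β : A) (I : Finset (Fin n))
    (E : (Fin n → A) → Set Ω) : Prop :=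
  ∀ s t : Fin n → A, EquivABI α β I s t → E s = E t

/-- An `(ℓ, r)`-simplicial process on `A^n`. -/
def IsSimplicial {A Ω : Type*} {n ℓ : ℕ} (r : Fin ℓ → ℕ)
    (S : (Fin n → A) → Set Ω) : Prop :=
  ∃ (β : Fin ℓ → A) (Γ : Fin ℓ → Finset A)
    (E : (l : Fin ℓ) → A → (Fin n → A) → Set Ω),
    (∀ l, (Γ l).Nonempty) ∧ (∀ l, ∀ α ∈ Γ l, α ≠ β l) ∧
    (∀ l, ∀ α ∈ Γ l, InsensitiveOn α (β l) (blockOf r n l) (E l α)) ∧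
    ∀ t : Fin n → A, S t = ⋂ l, ⋂ α ∈ Γ l, E l α t

/-- An `r`-variable word over `A` of length `n`: every variable appears, and the
appearances of the variables come in increasing order. -/
def IsVarWordM {A : Type*} {n r : ℕ} (w : Fin n → A ⊕ Fin r) : Prop :=
  (∀ l : Fin r, ∃ i, w i = Sum.inr l) ∧
    ∀ (i i' : Fin n) (l l' : Fin r),
      w i = Sum.inr l → w i' = Sum.inr l' → l < l' → i < i'

/-- The canonical isomorphism of the combinatorial space generated by an `r`-variable
word `w`: substitute `z l` for the variable `x_l`. -/
def embW {A : Type*} {n r : ℕ} (w : Fin n → A ⊕ Fin r) (z : Fin r → A) : Fin n → A :=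
  fun i => Sum.elim id z (w i)

/-- The rows of `L` satisfying `c`, with consecutive repetitions collapsed, where `last` is the
row satisfying `c` that was seen most recently before `L`. -/
def collapseFrom {X : Type*} [DecidableEq X] (c : X → Prop) [DecidablePred c] :
    Option X → List X → List X
  | _, [] => []
  | last, x :: L =>
    if c x ∧ last ≠ some x then x :: collapseFrom c (some x) L else collapseFrom c last L

section Collapse

variable {X Y V : Type*} [DecidableEq X] [DecidableEq Y] (c : X → Prop) [DecidablePred c]

theorem destutter'_filter_eq_collapseFrom (a : X) (L : List X) :
    (L.filter (fun x => decide (c x))).destutter' (· ≠ ·) a = a :: collapseFrom c (some a) L := by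
  induction L generalizing a with
  | nil => simp [collapseFrom]
  | cons x L ih =>
    by_cases hx : c x
    · by_cases hax : a = x
      · subst hax
        simp [collapseFrom, hx, ih]
      · simp [collapseFrom, hx, ih, hax]
    · simp [collapseFrom, hx, ih]

theorem destutter_filter_eq_collapseFrom (L : List X) :
    (L.filter (fun x => decide (c x))).destutter (· ≠ ·) = collapseFrom c none L := by
  induction L with
  | nil => simp [collapseFrom]
  | cons x L ih =>
    by_cases hx : c x
    · simp only [List.filter_cons, hx, decide_true, if_true, List.destutter_cons',
        destutter'_filter_eq_collapseFrom]
      simp [collapseFrom, hx]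
    · simp [collapseFrom, hx, ih]

variable {c}

theorem mem_of_mem_collapseFrom {last : Option X} {L : List X} {x : X}
    (h : x ∈ collapseFrom c last L) : x ∈ L := by
  induction L generalizing last with
  | nil => simp [collapseFrom] at h
  | cons y L ih =>
    rw [collapseFrom] at h
    split_ifs at h with hy
    · rcases List.mem_cons.1 h with rfl | h
      · simp
      · exact List.mem_cons_of_mem _ (ih h)
    · exact List.mem_cons_of_mem _ (ih h)

theorem mem_collapseFrom {last : Option X} {L : List X} {x : X} (hx : x ∈ L) (hc : c x) :
    x ∈ collapseFrom c last L ∨ last = some x := by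
  induction L generalizing last with
  | nil => simp at hx
  | cons y L ih =>
    rw [collapseFrom]
    rcases List.mem_cons.1 hx with rfl | hx
    · by_cases hl : last = some x
      · exact Or.inr hl
      · simp [hc, hl]
    · split_ifs with hy
      · rcases ih (last := some y) hx with h | h
        · exact Or.inl (List.mem_cons_of_mem _ h)
        · left
          simp_all
      · exact ih hx

theorem collapseFrom_map {c' : Y → Prop} [DecidablePred c'] {f : X → Y}
    (hf : ∀ x, ¬ c x → ¬ c' (f x)) (L : List X) (last : Option X) (last' : Option Y)
    (h : ∀ x, last = some x → c' (f x) → last' = some (f x)) :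
    collapseFrom c' last' (L.map f) =
      collapseFrom c' last' ((collapseFrom c last L).map f) := by
  induction L generalizing last last' with
  | nil => simp [collapseFrom]
  | cons x L ih =>
    rw [collapseFrom.eq_2 c]
    split_ifs with hx
    · simp only [List.map_cons, collapseFrom]
      split_ifs with hx'
      · congr 1
        exact ih _ _ (by simp)
      · refine ih _ _ ?_
        rintro y hy hcy
        obtain rfl : x = y := by simpa using hy
        by_contra hne
        exact hx' ⟨hcy, hne⟩
    · rw [List.map_cons, collapseFrom, if_neg, ih _ _ h]
      rintro ⟨h1, h2⟩
      have hcx : c x := by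
        by_contra hcx
        exact hf x hcx h1
      have hl : last = some x := by
        by_contra hl
        exact hx ⟨hcx, hl⟩
      exact h2 (h x hl h1)

theorem collapseFrom_append_of_redundant (last : Option X) (L₁ L₂ : List X)
    (h : ∀ x ∈ L₁, c x → last = some x) :
    collapseFrom c last (L₁ ++ L₂) = collapseFrom c last L₂ := by
  induction L₁ with
  | nil => simp
  | cons x L ih =>
    rw [List.cons_append, collapseFrom, if_neg, ih fun y hy => h y (List.mem_cons_of_mem _ hy)]
    rintro ⟨h1, h2⟩
    exact h2 (h x (by simp) h1)

theorem collapseFrom_append_right (last : Option X) (L₁ L₂ : List X) (h : ∀ x ∈ L₂, ¬ c x) :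
    collapseFrom c last (L₁ ++ L₂) = collapseFrom c last L₁ := by
  induction L₁ generalizing last with
  | nil =>
    simpa using collapseFrom_append_of_redundant last L₂ []
      (fun x hx hc => absurd hc (h x hx))
  | cons x L ih => simp [collapseFrom, ih]

/-- Rows carrying lists of variables can be rearranged into a list of fixed rows and variable rows
with as few fixed rows as possible, in such a way that replacing some of the variable rows
by rows violating `c` does not change the collapsed list. -/
theorem exists_variable_rows (L : List (X × List V)) (last : Option X) :
    ∃ B : List (X × Option V),
      B.filterMap Prod.snd = L.flatMap Prod.snd ∧
      B.length = (collapseFrom c last (L.map Prod.fst)).length + (L.flatMap Prod.snd).length ∧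
      (∀ x v, (x, some v) ∈ B → ∃ vs, (x, vs) ∈ L ∧ v ∈ vs) ∧
      ∀ f : X → Option V → X, (∀ x, f x none = x) → (∀ x v, c (f x v) → f x v = x) →
        collapseFrom c last (B.map fun b => f b.1 b.2) =
          collapseFrom c last (L.map Prod.fst) := by
  induction L generalizing last with
  | nil => exact ⟨[], by simp [collapseFrom]⟩
  | cons y L ih =>
    obtain ⟨x, vs⟩ := y
    have hfm : ∀ us : List V, (us.map fun v => (x, some v)).filterMap Prod.snd = us := by
      intro us
      induction us with
      | nil => rfl
      | cons u us ihu => simp [ihu]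
    by_cases hx : c x ∧ last ≠ some x
    · obtain ⟨B, h1, h2, h3, h4⟩ := ih (some x)
      refine ⟨(x, none) :: ((vs.map fun v => (x, some v)) ++ B), ?_, ?_, ?_, ?_⟩
      · rw [List.filterMap_cons_none rfl, List.filterMap_append, hfm, h1]
        simp
      · simp [collapseFrom, hx, h2]
        omega
      · intro x' v hmem
        simp only [List.mem_cons, Prod.mk.injEq, reduceCtorEq, and_false, List.mem_append,
          List.mem_map, Option.some.injEq, false_or] at hmem
        rcases hmem with ⟨u, hu, rfl, rfl⟩ | hmem
        · exact ⟨vs, by simp, hu⟩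
        · obtain ⟨us, hus, hv⟩ := h3 _ _ hmem
          exact ⟨us, List.mem_cons_of_mem _ hus, hv⟩
      · intro f hf0 hf
        simp only [List.map_cons, List.map_append, hf0]
        rw [collapseFrom, if_pos hx, collapseFrom, if_pos hx, collapseFrom_append_of_redundant,
          h4 f hf0 hf]
        intro y hy hcy
        simp only [List.map_map, List.mem_map, Function.comp] at hy
        obtain ⟨v, -, rfl⟩ := hy
        rw [hf _ _ hcy]
    · obtain ⟨B, h1, h2, h3, h4⟩ := ih last
      refine ⟨(vs.map fun v => (x, some v)) ++ B, ?_, ?_, ?_, ?_⟩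
      · rw [List.filterMap_append, hfm, h1]
        simp
      · rw [List.map_cons, collapseFrom, if_neg hx]
        simp [h2]
        omega
      · intro x' v hmem
        simp only [Prod.mk.injEq, List.mem_append, List.mem_map, Option.some.injEq] at hmem
        rcases hmem with ⟨u, hu, rfl, rfl⟩ | hmem
        · exact ⟨vs, by simp, hu⟩
        · obtain ⟨us, hus, hv⟩ := h3 _ _ hmem
          exact ⟨us, List.mem_cons_of_mem _ hus, hv⟩
      · intro f hf0 hf
        simp only [List.map_cons, List.map_append]
        rw [collapseFrom.eq_2 c, if_neg hx, collapseFrom_append_of_redundant, h4 f hf0 hf]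
        intro y hy hcy
        simp only [List.map_map, List.mem_map, Function.comp] at hy
        obtain ⟨v, -, rfl⟩ := hy
        have hxv := hf _ _ hcy
        rw [hxv] at hcy ⊢
        by_contra hl
        exact hx ⟨hcy, hl⟩

end Collapse

theorem typeRows_eq_collapseFrom {A : Type*} [DecidableEq A] {n p : ℕ} (t : Fin p → Fin n → A) :
    typeRows t = collapseFrom (fun x : Fin p → A => ∃ j j', x j ≠ x j') none
      ((List.finRange n).map fun i j => t j i) :=
  destutter_filter_eq_collapseFrom (fun x : Fin p → A => ∃ j j', x j ≠ x j') _

/-- Tuples of the same type have subtuples of the same type. -/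
theorem typeRows_comp_eq {A : Type*} [DecidableEq A] {n m p q : ℕ} {t : Fin p → Fin n → A}
    {s : Fin p → Fin m → A} (h : typeRows s = typeRows t) (e : Fin q → Fin p) :
    typeRows (fun j => s (e j)) = typeRows (fun j => t (e j)) := by
  have key : ∀ {k : ℕ} (u : Fin p → Fin k → A), typeRows (fun j => u (e j)) =
      collapseFrom (fun x : Fin q → A => ∃ j j', x j ≠ x j') none
        ((typeRows u).map fun x j => x (e j)) := by
    intro k u
    rw [typeRows_eq_collapseFrom, typeRows_eq_collapseFrom, ← collapseFrom_map]
    · rw [List.map_map]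
      rfl
    · rintro x hx ⟨j, j', hj⟩
      exact hx ⟨_, _, hj⟩
    · simp
  rw [key, key, h]

theorem injective_of_typeRows_eq {A : Type*} [DecidableEq A] {n m p : ℕ} {t : Fin p → Fin n → A}
    {s : Fin p → Fin m → A} (h : typeRows s = typeRows t) (ht : Function.Injective t) :
    Function.Injective s := by
  intro a b hab
  by_contra hne
  obtain ⟨i, hi⟩ := Function.ne_iff.1 (ht.ne hne)
  have hmem : (fun j => t j i) ∈ typeRows t := by
    rw [typeRows_eq_collapseFrom]
    refine (mem_collapseFrom (List.mem_map.2 ⟨i, List.mem_finRange i, rfl⟩) ⟨a, b, hi⟩).resolve_right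
      (by simp)
  rw [← h, typeRows_eq_collapseFrom] at hmem
  obtain ⟨k, -, hk⟩ := List.mem_map.1 (mem_of_mem_collapseFrom hmem)
  exact hi (by rw [← congrFun hk a, ← congrFun hk b, hab])

theorem sameType_image {A : Type*} [DecidableEq A] {n m p : ℕ} {t : Fin p → Fin n → A}
    {s : Fin p → Fin m → A} (h : typeRows s = typeRows t) (ht : Function.Injective t) :
    SameType (Finset.univ.image s) (Finset.univ.image t) :=
  ⟨p, s, t, injective_of_typeRows_eq h ht, ht, by simp, by simp, h⟩

/-- The blocks partition the coordinates, in increasing order. -/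
theorem exists_block_label {ℓ : ℕ} (r : Fin ℓ → ℕ) :
    ∃ lab : Fin (∑ l, r l) → Fin ℓ, Monotone lab ∧
      ∀ v l, v ∈ blockOf r (∑ l, r l) l ↔ lab v = l := by
  have hle : ∀ {v v' : Fin (∑ l, r l)} {l l' : Fin ℓ}, v ∈ blockOf r _ l → v' ∈ blockOf r _ l' →
      v ≤ v' → l ≤ l' := by
    intro v v' l l' hv hv' hvv
    by_contra! hl
    have hsub : ∑ k ∈ Finset.Iic l', r k ≤ ∑ k ∈ Finset.Iio l, r k :=
      Finset.sum_le_sum_of_subset fun k hk =>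
        Finset.mem_Iio.2 ((Finset.mem_Iic.1 hk).trans_lt hl)
    simp only [blockOf, Finset.mem_filter, Finset.mem_univ, true_and] at hv hv'
    have : (v : ℕ) ≤ v' := hvv
    omega
  have hex : ∀ v : Fin (∑ l, r l), ∃ l, v ∈ blockOf r _ l := by
    intro v
    by_contra! hno
    have hall : ∀ k : ℕ, ∀ hk : k < ℓ, ∑ l ∈ Finset.Iic (⟨k, hk⟩ : Fin ℓ), r l ≤ v := by
      intro k
      induction k using Nat.strong_induction_on with
      | _ k ih =>
        intro hk
        by_contra! hlt
        refine hno ⟨k, hk⟩ ?_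
        simp only [blockOf, Finset.mem_filter, Finset.mem_univ, true_and]
        refine ⟨?_, hlt⟩
        rcases k with _ | k
        · have : Finset.Iio (⟨0, hk⟩ : Fin ℓ) = ∅ := by
            ext x
            simp [Fin.lt_def]
          simp [this]
        · have : Finset.Iio (⟨k + 1, hk⟩ : Fin ℓ) = Finset.Iic ⟨k, by omega⟩ := by
            ext x
            simp [Fin.lt_def, Fin.le_def]
          rw [this]
          exact ih k (by omega) _
    rcases ℓ with _ | ℓ
    · exact absurd v.2 (by simp)
    · have h := hall ℓ (by omega)
      have hu : Finset.Iic (⟨ℓ, by omega⟩ : Fin (ℓ + 1)) = Finset.univ := by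
        ext x
        simp [Fin.le_def]
        omega
      rw [hu] at h
      exact absurd v.2 (by omega)
  choose lab hlab using hex
  refine ⟨lab, fun v v' h => hle (hlab v) (hlab v') h, fun v l => ⟨fun h => ?_, ?_⟩⟩
  · exact le_antisymm (hle (hlab v) h le_rfl) (hle h (hlab v) le_rfl)
  · rintro rfl
    exact hlab v

theorem flatMap_fiber_finRange {n N : ℕ} {g : Fin N → Fin n} (hg : Monotone g) :
    (List.finRange n).flatMap (fun i => (List.finRange N).filter (fun v => g v = i)) =
      List.finRange N := by
  have hsort : ((List.finRange n).flatMap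
      (fun i => (List.finRange N).filter (fun v => g v = i))).Pairwise (· < ·) := by
    rw [List.pairwise_flatMap]
    refine ⟨fun i _ => (List.pairwise_lt_finRange N).filter _, ?_⟩
    refine (List.pairwise_lt_finRange n).imp ?_
    intro a b hab x hx y hy
    simp only [List.mem_filter, List.mem_finRange, true_and, decide_eq_true_eq] at hx hy
    by_contra! hyx
    have := hg hyx
    rw [hx, hy] at this
    exact absurd hab (not_lt.2 this)
  refine List.Perm.eq_of_pairwise' hsort (List.pairwise_lt_finRange N) ?_
  refine (List.perm_ext_iff_of_nodup (hsort.imp ne_of_lt) (List.nodup_finRange N)).2 ?_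
  simp

/-- A family of tuples of the same type as `t`, whose last entries run over a combinatorial
subspace, where the entries of the rows at the variables are governed by the rows `g v` of `t`. -/
theorem exists_varWord_family {A : Type*} [DecidableEq A] {n p N : ℕ}
    (t : Fin (p + 1) → Fin n → A) (g : Fin N → Fin n) (hg : Monotone g)
    (hlen : (typeRows t).length + N ≤ n) :
    ∃ (w : Fin n → A ⊕ Fin N) (s : (Fin N → A) → Fin (p + 1) → Fin n → A),
      IsVarWordM w ∧ (∀ z, s z (Fin.last p) = embW w z) ∧ (∀ z, typeRows (s z) = typeRows t) ∧
      (∀ i a, w i = Sum.inl a → ∀ z z', ∀ q, s z q i = s z' q i) ∧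
      (∀ i v, w i = Sum.inr v → ∀ z q, s z q i =
        if z v = t (Fin.last p) (g v) then t q (g v) else z v) := by
  classical
  rcases Nat.eq_zero_or_pos n with rfl | hn
  · have hN : N = 0 := by omega
    subst hN
    refine ⟨fun i => i.elim0, fun _ => t, ⟨fun l => l.elim0, fun i => i.elim0⟩, ?_, fun _ => rfl,
      fun i => i.elim0, fun i => i.elim0⟩
    intro z
    funext i
    exact i.elim0
  let i₀ : Fin n := ⟨0, hn⟩
  set L : List ((Fin (p + 1) → A) × List (Fin N)) := (List.finRange n).map
    fun i => (fun j => t j i, (List.finRange N).filter fun v => g v = i) with hL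
  have hfst : L.map Prod.fst = (List.finRange n).map fun i j => t j i := by
    simp [hL]
  have hsnd : L.flatMap Prod.snd = List.finRange N := by
    rw [hL, List.flatMap_map]
    exact flatMap_fiber_finRange hg
  obtain ⟨B, h1, h2, h3, h4⟩ := exists_variable_rows
    (c := fun x : Fin (p + 1) → A => ∃ j j', x j ≠ x j') L none
  rw [hfst, ← typeRows_eq_collapseFrom] at h2 h4
  rw [hsnd] at h1 h2
  rw [List.length_finRange] at h2
  set B' := B ++ List.replicate (n - B.length) ((fun _ => t 0 i₀ : Fin (p + 1) → A), none) with hB'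
  have hB'len : B'.length = n := by
    simp [hB']
    omega
  have hB'v : B'.filterMap Prod.snd = List.finRange N := by
    rw [hB', List.filterMap_append, h1]
    simp
  have hB'row : ∀ x v, (x, some v) ∈ B' → x = fun j => t j (g v) := by
    intro x v hmem
    have hmem' : (x, some v) ∈ B := by
      simpa [hB', List.mem_replicate] using hmem
    obtain ⟨vs, hvs, hv⟩ := h3 _ _ hmem'
    simp only [hL, List.mem_map, List.mem_finRange, true_and, Prod.mk.injEq] at hvs
    obtain ⟨i, rfl, rfl⟩ := hvs
    simp only [List.mem_filter, List.mem_finRange, true_and, decide_eq_true_eq] at hv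
    rw [hv]
  let b : Fin n → (Fin (p + 1) → A) × Option (Fin N) := fun i => B'.get (i.cast hB'len.symm)
  have hb : ∀ i, b i ∈ B' := fun i => List.get_mem _ _
  have hbmap : (List.finRange n).map b = B' := by
    apply List.ext_get
    · simp [hB'len]
    · intro k hk hk'
      simp [b]
  let f : (Fin N → A) → (Fin (p + 1) → A) → Option (Fin N) → (Fin (p + 1) → A) :=
    fun z x o => o.elim x fun v => if z v = x (Fin.last p) then x else fun _ => z v
  let w : Fin n → A ⊕ Fin N := fun i => (b i).2.elim (Sum.inl ((b i).1 (Fin.last p))) Sum.inr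
  have hwr : ∀ i v, w i = Sum.inr v ↔ (b i).2 = some v := by
    intro i v
    simp only [w]
    cases (b i).2 <;> simp
  refine ⟨w, fun z q i => f z (b i).1 (b i).2 q, ⟨?_, ?_⟩, ?_, ?_, ?_, ?_⟩
  · intro v
    have hv : v ∈ B'.filterMap Prod.snd := by simp [hB'v]
    rw [← hbmap] at hv
    simp only [List.mem_filterMap, List.mem_map, List.mem_finRange, true_and,
      exists_exists_eq_and] at hv
    obtain ⟨i, hi⟩ := hv
    exact ⟨i, (hwr i v).2 hi⟩
  · intro i i' v v' hi hi' hvv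
    rw [hwr] at hi hi'
    by_contra! hle
    rcases hle.eq_or_lt with rfl | hlt
    · rw [hi] at hi'
      exact absurd (Option.some.inj hi') hvv.ne
    · have hpw := List.pairwise_lt_finRange N
      rw [← hB'v, List.pairwise_filterMap, List.pairwise_iff_get] at hpw
      have := hpw (i'.cast hB'len.symm) (i.cast hB'len.symm) hlt v' hi' v hi
      exact absurd this (not_lt.2 hvv.le)
  · intro z
    funext i
    simp only [embW, w, f]
    cases (b i).2 with
    | none => simp
    | some v =>
      simp only [Option.elim_some, Sum.elim_inr]
      split_ifs with h
      · exact h.symm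
      · rfl
  · intro z
    have hrows : ((List.finRange n).map fun i j => f z (b i).1 (b i).2 j) =
        B'.map fun y => f z y.1 y.2 := by
      rw [← hbmap, List.map_map]
      rfl
    rw [typeRows_eq_collapseFrom, hrows, hB', List.map_append, collapseFrom_append_right, h4]
    · intro x
      rfl
    · rintro x (_ | v) ⟨j, j', hj⟩
      · rfl
      · simp only [f, Option.elim_some] at hj ⊢
        split_ifs at hj ⊢ with h
        · rfl
        · exact absurd rfl hj
    · intro x hx
      simp only [List.map_replicate, List.mem_replicate] at hx
      rw [hx.2]
      simp [f]
  · intro i a hi z z' q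
    simp only [w] at hi
    cases ho : (b i).2 with
    | none => simp [f, ho]
    | some v => simp [ho] at hi
  · intro i v hi z q
    rw [hwr] at hi
    have hx := hB'row (b i).1 v (by rw [← hi]; exact hb i)
    simp only [hi, f, Option.elim_some]
    rw [hx]
    split_ifs <;> rfl

theorem stmt18 {A Ω : Type*} [Fintype A] [DecidableEq A] [MeasurableSpace Ω]
    (hA : 2 ≤ Fintype.card A) {n p ℓ d : ℕ} (hp : 0 < p) (hℓ : 0 < ℓ)
    (hpn : p + 1 ≤ Fintype.card A ^ n)
    (η ε θ σ : ℝ) (hη : 0 < η) (hη1 : η ≤ 1) (hε : 0 < ε) (hε1 : ε ≤ 1)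
    (hθ : 0 < θ) (hθ1 : θ ≤ 1) (hσ : 0 < σ) (hσ1 : σ ≤ 1)
    (P : Measure Ω) [IsProbabilityMeasure P]
    (D : (Fin n → A) → Set Ω) (hmeas : ∀ t, MeasurableSet (D t))
    (hstat : StationaryTypes P D η) (hPD : ∀ t, |(P (D t)).toReal - ε| ≤ η)
    (t : Fin (p + 1) → Fin n → A) (ht : Function.Injective t)
    (htsep : sepIndexTuple t = ℓ) (hd : (typeRows t).length = d)
    (G H : Finset (Fin n → A))
    (hG : G = Finset.image t Finset.univ)
    (hH : H = Finset.image (fun j : Fin p => t j.castSucc) Finset.univ)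
    (r : Fin ℓ → ℕ) (hr : ∀ l, 0 < r l) (hrsum : ∑ l, r l ≤ n - d)
    (hpseudo : ∀ G' : Finset (Fin n → A), SameType G' H →
      |(P (⋂ x ∈ G', D x)).toReal - ε ^ G'.card| ≤ θ)
    (hsuper : ∀ G' : Finset (Fin n → A), SameType G' G →
      (P (⋂ x ∈ G', D x)).toReal ≥ ε ^ G'.card + σ) :
    ∃ (w : Fin n → A ⊕ Fin (∑ l, r l)) (S : (Fin (∑ l, r l) → A) → Set Ω),
      IsVarWordM w ∧ IsSimplicial r S ∧
      ∀ z : Fin (∑ l, r l) → A,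
        |(P (S z)).toReal - ε ^ p| ≤ θ ∧
        (P (D (embW w z) ∩ S z)).toReal / (P (S z)).toReal ≥
          ε * (1 + (σ * ε⁻¹ - θ) / (ε ^ p + θ)) := by
  classical
  have hsep : SepTuple ℓ t := by
    have hne : {k | 0 < k ∧ SepTuple k t}.Nonempty :=
      Nat.nonempty_of_pos_sInf (hℓ.trans_eq htsep.symm)
    have hmem := Nat.sInf_mem hne
    rw [← htsep]
    exact hmem.2
  obtain ⟨I, hIcard, hI⟩ := hsep (Fin.last p) hp
  obtain ⟨lab, hlabmono, hlab⟩ := exists_block_label r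
  let e : Fin ℓ ↪o Fin n := I.orderEmbOfFin hIcard
  have hsumpos : 0 < ∑ l, r l :=
    Finset.sum_pos (fun l _ => hr l) ⟨⟨0, hℓ⟩, Finset.mem_univ _⟩
  obtain ⟨w, s, hw, hlast, htype, hconst, hvar⟩ :=
    exists_varWord_family t (fun v => e (lab v)) (e.monotone.comp hlabmono) (by omega)
  have hq : ∀ q : Fin p, ∃ l, t q.castSucc (e l) ≠ t (Fin.last p) (e l) := by
    intro q
    obtain ⟨i, hi, hne⟩ := hI q.castSucc q.2
    have : i ∈ Set.range e := by
      simpa [e] using hi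
    obtain ⟨l, rfl⟩ := this
    exact ⟨l, hne.symm⟩
  choose k hk using hq
  refine ⟨w, fun z => ⋂ q : Fin p, D (s z q.castSucc), hw, ?_, ?_⟩
  · refine ⟨fun l => t (Fin.last p) (e l), fun l => Finset.univ.erase (t (Fin.last p) (e l)),
      fun l α z => ⋂ q : Fin p, ⋂ _ : k q = l ∧ t q.castSucc (e l) = α, D (s z q.castSucc),
      ?_, ?_, ?_, ?_⟩
    · intro l
      rw [← Finset.card_pos, Finset.card_erase_of_mem (Finset.mem_univ _), Finset.card_univ]
      omega
    · intro l α hα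
      exact (Finset.mem_erase.1 hα).1
    · intro l α hα z z' hzz
      refine Set.iInter_congr fun q => Set.iInter_congr ?_
      rintro ⟨hql, hqα⟩
      congr 1
      funext i
      rcases hwi : w i with a | v
      · exact hconst i a hwi z z' _
      · rw [hvar i v hwi, hvar i v hwi]
        by_cases hv : v ∈ blockOf r _ l
        · have hz := hzz.2 v hv
          rw [(hlab v l).1 hv, hqα]
          have h1 := hz (z v)
          have h2 := hz (z' v)
          split_ifs <;> grind
        · rw [hzz.1 v hv]
    · intro z
      ext x
      simp only [Set.mem_iInter, Finset.mem_erase, Finset.mem_univ, and_true]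
      refine ⟨fun h l α _ q _ => h q, fun h q => h (k q) _ (hk q) q ⟨rfl, rfl⟩⟩
  · intro z
    have hinj := injective_of_typeRows_eq (htype z) ht
    have hSH : |(P (⋂ q : Fin p, D (s z q.castSucc))).toReal - ε ^ p| ≤ θ := by
      have h := hpseudo (Finset.univ.image fun q : Fin p => s z q.castSucc)
        (hH ▸ sameType_image (typeRows_comp_eq (htype z) Fin.castSucc)
          (ht.comp (Fin.castSucc_injective p)))
      have hinj' : Function.Injective fun q : Fin p => s z q.castSucc :=
        hinj.comp (Fin.castSucc_injective p)
      rw [Finset.card_image_of_injective _ hinj', Finset.set_biInter_finset_image] at h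
      simpa using h
    have hSG : ε ^ (p + 1) + σ ≤
        (P (D (embW w z) ∩ ⋂ q : Fin p, D (s z q.castSucc))).toReal := by
      have h := hsuper (Finset.univ.image (s z)) (hG ▸ sameType_image (htype z) ht)
      have hinter : ⋂ q : Fin (p + 1), D (s z q) =
          D (embW w z) ∩ ⋂ q : Fin p, D (s z q.castSucc) := by
        ext x
        simp only [Set.mem_iInter, Set.mem_inter_iff, Fin.forall_fin_succ', hlast, and_comm]
      rw [Finset.card_image_of_injective _ hinj, Finset.set_biInter_finset_image] at h
      simpa [hinter] using h
    refine ⟨hSH, ?_⟩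
    have hmono : (P (D (embW w z) ∩ ⋂ q : Fin p, D (s z q.castSucc))).toReal ≤
        (P (⋂ q : Fin p, D (s z q.castSucc))).toReal :=
      ENNReal.toReal_mono (measure_ne_top _ _) (measure_mono Set.inter_subset_right)
    have hεp : 0 < ε ^ p := pow_pos hε p
    have hεp1 : 0 < ε ^ (p + 1) := pow_pos hε (p + 1)
    have hle := (abs_le.1 hSH).2
    have hrhs : ε * (1 + (σ * ε⁻¹ - θ) / (ε ^ p + θ)) = (ε ^ (p + 1) + σ) / (ε ^ p + θ) := by
      have : ε ^ p + θ ≠ 0 := by positivity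
      field_simp
      ring
    rw [ge_iff_le, hrhs]
    exact div_le_div₀ ENNReal.toReal_nonneg hSG (by linarith) (by linarith)
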